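/- arXiv:0910.1954 — 2 statements merged into one kernel-verified Lean document; each statement's English description precedes it below -/
import Mathlib

section
/- Assume p01 ≤ p11. Then for every t ∈ {1,…,T} and every information state ω ∈ [0,1]^n, any greedy set g for ω achieves the maximum in the dynamic programming recursion: Q_t(ω, g) ≥ Q_t(ω, a) for every subset a ⊆ {1,…,n} with |a| = k, and hence V_t(ω) = Q_t(ω, g). (Here Q_T(ω, a) := Σ_{i∈a} ω_i.) -/
open Finset

noncomputable section

/-- The one-step belief update for an unobserved channel. -/
def tauF (p01 p11 : ℝ) (w : ℝ) : ℝ := w * p11 + (1 - w) * p01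

/-- The set of admissible actions: subsets of `Fin n` of cardinality `k`. -/
def actions (n k : ℕ) : Finset (Finset (Fin n)) :=
  (Finset.univ : Finset (Fin n)).powersetCard k

lemma actions_nonempty {n k : ℕ} (hk : k ≤ n) : (actions n k).Nonempty := by
  rw [actions, Finset.powersetCard_nonempty, Finset.card_univ, Fintype.card_fin]
  exact hk

/-- Number of `true` entries in a `{0,1}^k` realization. -/
def countTrue {k : ℕ} (l : Fin k → Bool) : ℕ :=
  (Finset.univ.filter fun i => l i = true).card

/-- `q(l; u) = ∏ u_i^{l_i} (1-u_i)^{1-l_i}`. -/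
def qProb {k : ℕ} (u : Fin k → ℝ) (l : Fin k → Bool) : ℝ :=
  ∏ i : Fin k, if l i then u i else 1 - u i

/-- The top `k` coordinates `(ω_{n-k+1}, …, ω_n)` of a length-`n` vector. -/
def topCoords {n k : ℕ} (hk : k ≤ n) (ω : Fin n → ℝ) : Fin k → ℝ :=
  fun i => ω ⟨n - k + i.val, by omega⟩

/-- The vector `v_l`: `k - m` copies of `p01`, then `τ(ω_1),…,τ(ω_{n-k})`,
then `m` copies of `p11`, where `m` is the number of ones in `l`. -/
def vl {n : ℕ} (k : ℕ) (p01 p11 : ℝ) (ω : Fin n → ℝ) (m : ℕ) : Fin n → ℝ :=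
  fun j =>
    if j.val < k - m then p01
    else if j.val < n - m then tauF p01 p11 (ω ⟨j.val - (k - m), by omega⟩)
    else p11

/-- The greedy-policy value functions `W`, indexed by the number of remaining
steps (`r = 0` corresponds to the terminal time `T`). -/
def Wval (n k : ℕ) (hk : k ≤ n) (p01 p11 β : ℝ) : ℕ → (Fin n → ℝ) → ℝ
  | 0, ω => ∑ i : Fin n, if n - k ≤ i.val then ω i else 0
  | r + 1, ω =>
      (∑ i : Fin n, if n - k ≤ i.val then ω i else 0) +
        β * ∑ l : Fin k → Bool,
          qProb (topCoords hk ω) l *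
            Wval n k hk p01 p11 β r (vl k p01 p11 ω (countTrue l))

/-- The updated information state `ω^{a,s}`. -/
def nextState {n : ℕ} (p01 p11 : ℝ) (ω : Fin n → ℝ) (a : Finset (Fin n))
    (s : {i // i ∈ a} → Bool) : Fin n → ℝ :=
  fun j => if h : j ∈ a then (if s ⟨j, h⟩ then p11 else p01) else tauF p01 p11 (ω j)

/-- The probability of the realization `s` of the selected channels `a`. -/
def obsProb {n : ℕ} (ω : Fin n → ℝ) (a : Finset (Fin n))
    (s : {i // i ∈ a} → Bool) : ℝ :=
  ∏ i : {i // i ∈ a}, if s i then ω i.val else 1 - ω i.val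

/-- The optimal value functions `V`, indexed by the number of remaining steps. -/
def Vval (n k : ℕ) (hk : k ≤ n) (p01 p11 β : ℝ) : ℕ → (Fin n → ℝ) → ℝ
  | 0, ω => (actions n k).sup' (actions_nonempty hk) fun a => ∑ i ∈ a, ω i
  | r + 1, ω =>
      (actions n k).sup' (actions_nonempty hk) fun a =>
        (∑ i ∈ a, ω i) +
          β * ∑ s : {i // i ∈ a} → Bool,
            obsProb ω a s * Vval n k hk p01 p11 β r (nextState p01 p11 ω a s)

/-- `Q_t(ω, a)`: the value of taking action `a` now and acting optimally
afterwards, indexed by the number of remaining steps. -/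
def Qval (n k : ℕ) (hk : k ≤ n) (p01 p11 β : ℝ) : ℕ → (Fin n → ℝ) → Finset (Fin n) → ℝ
  | 0, ω, a => ∑ i ∈ a, ω i
  | r + 1, ω, a =>
      (∑ i ∈ a, ω i) +
        β * ∑ s : {i // i ∈ a} → Bool,
          obsProb ω a s * Vval n k hk p01 p11 β r (nextState p01 p11 ω a s)

/-- Replace the coordinates in positions `j` and `j+1` (`0`-indexed) by `x` and `y`. -/
def upd2 {n : ℕ} (ω : Fin n → ℝ) (j : ℕ) (hj : j + 1 < n) (x y : ℝ) : Fin n → ℝ :=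
  Function.update (Function.update ω ⟨j, by omega⟩ x) ⟨j + 1, hj⟩ y

/-- The cyclic shift `(ω_2, …, ω_n, ω_1)`. -/
def cyc {n : ℕ} (hn : 0 < n) (ω : Fin n → ℝ) : Fin n → ℝ :=
  fun j => ω ⟨(j.val + 1) % n, Nat.mod_lt _ hn⟩

end


/-- The expectation of `f i j`, where `i` and `j` count the successes and failures of independent
Bernoulli trials with the success probabilities listed. -/
noncomputable def bernoulliExp : List ℝ → (ℕ → ℕ → ℝ) → ℝ
  | [], f => f 0 0
  | u :: us, f =>
      u * bernoulliExp us (fun i j => f (i + 1) j) +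
        (1 - u) * bernoulliExp us (fun i j => f i (j + 1))

lemma bernoulliExp_perm {l l' : List ℝ} (h : l.Perm l') (f : ℕ → ℕ → ℝ) :
    bernoulliExp l f = bernoulliExp l' f := by
  induction h generalizing f with
  | nil => rfl
  | cons x _ ih => simp only [bernoulliExp, ih]
  | swap x y l => simp only [bernoulliExp]; ring
  | trans _ _ ih₁ ih₂ => rw [ih₁, ih₂]

lemma bernoulliExp_mono {l : List ℝ} (hl : ∀ z ∈ l, z ∈ Set.Icc (0 : ℝ) 1)
    {f g : ℕ → ℕ → ℝ} (h : ∀ i j, f i j ≤ g i j) :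
    bernoulliExp l f ≤ bernoulliExp l g := by
  induction l generalizing f g with
  | nil => exact h 0 0
  | cons u us ih =>
    have hu := hl u (by simp)
    have hus : ∀ z ∈ us, z ∈ Set.Icc (0 : ℝ) 1 := fun z hz => hl z (by simp [hz])
    simp only [bernoulliExp]
    exact add_le_add
      (mul_le_mul_of_nonneg_left (ih hus fun i j => h _ _) hu.1)
      (mul_le_mul_of_nonneg_left (ih hus fun i j => h _ _) (by linarith [hu.2]))

lemma bernoulliExp_add_mul (l : List ℝ) (a b : ℝ) (f g : ℕ → ℕ → ℝ) :
    bernoulliExp l (fun i j => a * f i j + b * g i j) =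
      a * bernoulliExp l f + b * bernoulliExp l g := by
  induction l generalizing f g with
  | nil => rfl
  | cons u us ih => simp only [bernoulliExp, ih]; ring

lemma bernoulliExp_const (l : List ℝ) (c : ℝ) : bernoulliExp l (fun _ _ => c) = c := by
  induction l with
  | nil => rfl
  | cons u us ih => simp only [bernoulliExp, ih]; ring

lemma bernoulliExp_affine (l₁ l₂ : List ℝ) (x a b : ℝ) (f : ℕ → ℕ → ℝ) :
    bernoulliExp (l₁ ++ (x * a + (1 - x) * b) :: l₂) f =
      x * bernoulliExp (l₁ ++ a :: l₂) f + (1 - x) * bernoulliExp (l₁ ++ b :: l₂) f := by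
  induction l₁ generalizing f with
  | nil => simp only [List.nil_append, bernoulliExp]; ring
  | cons u us ih => simp only [List.cons_append, bernoulliExp, ih]; ring

lemma mul_bernoulliExp_le {l : List ℝ} (hl : ∀ z ∈ l, z ∈ Set.Icc (0 : ℝ) 1) {c β : ℝ}
    {f g : ℕ → ℕ → ℝ} (h : ∀ i j, β * f i j ≤ c + β * g i j) :
    β * bernoulliExp l f ≤ c + β * bernoulliExp l g := by
  have h₁ := bernoulliExp_add_mul l β 0 f f
  have h₂ := bernoulliExp_add_mul l 1 β (fun _ _ => c) g
  rw [bernoulliExp_const] at h₂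
  have h₃ := bernoulliExp_mono hl (f := fun i j => β * f i j + 0 * f i j)
    (g := fun i j => 1 * c + β * g i j) (fun i j => by linarith [h i j])
  linarith

/-- The value of the policy that always probes the first `K` entries of a list of beliefs, then
moves the successes to the front and the failures to the back. -/
noncomputable def listValue (K : ℕ) (p01 p11 β : ℝ) : ℕ → List ℝ → ℝ
  | 0, l => (l.take K).sum
  | r + 1, l => (l.take K).sum + β * bernoulliExp (l.take K) fun i j =>
      listValue K p01 p11 β r
        (List.replicate i p11 ++ (l.drop K).map (tauF p01 p11) ++ List.replicate j p01)

section listValue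

variable {K : ℕ} {p01 p11 β : ℝ}

lemma tauF_mem (h0 : p01 ∈ Set.Icc (0 : ℝ) 1) (h1 : p11 ∈ Set.Icc (0 : ℝ) 1) {w : ℝ}
    (hw : w ∈ Set.Icc (0 : ℝ) 1) : tauF p01 p11 w ∈ Set.Icc (0 : ℝ) 1 := by
  obtain ⟨a, b⟩ := h0
  obtain ⟨c, d⟩ := h1
  obtain ⟨e, f⟩ := hw
  unfold tauF
  constructor <;> nlinarith

lemma tauF_mono (hord : p01 ≤ p11) : Monotone (tauF p01 p11) := by
  intro x y hxy
  unfold tauF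
  nlinarith

lemma tauF_one : tauF p01 p11 1 = p11 := by simp [tauF]

lemma tauF_zero : tauF p01 p11 0 = p01 := by simp [tauF]

lemma le_tauF (hord : p01 ≤ p11) {w : ℝ} (hw : w ∈ Set.Icc (0 : ℝ) 1) :
    p01 ≤ tauF p01 p11 w := by
  simpa [tauF_zero] using tauF_mono hord hw.1

lemma tauF_le (hord : p01 ≤ p11) {w : ℝ} (hw : w ∈ Set.Icc (0 : ℝ) 1) :
    tauF p01 p11 w ≤ p11 := by
  simpa [tauF_one] using tauF_mono hord hw.2

lemma tauF_affine (x a b : ℝ) : tauF p01 p11 (x * a + (1 - x) * b) =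
    x * tauF p01 p11 a + (1 - x) * tauF p01 p11 b := by
  unfold tauF; ring

lemma listValue_congr {l l' : List ℝ} (ht : (l.take K).Perm (l'.take K))
    (hd : l.drop K = l'.drop K) (r : ℕ) :
    listValue K p01 p11 β r l = listValue K p01 p11 β r l' := by
  cases r with
  | zero => exact ht.sum_eq
  | succ r => simp only [listValue]; rw [ht.sum_eq, hd, bernoulliExp_perm ht]

lemma listValue_zero_append (u A : List ℝ) :
    listValue u.length p01 p11 β 0 (u ++ A) = u.sum := by
  simp [listValue]

lemma listValue_succ_append (u A : List ℝ) (r : ℕ) :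
    listValue u.length p01 p11 β (r + 1) (u ++ A) = u.sum + β * bernoulliExp u fun i j =>
      listValue u.length p01 p11 β r
        (List.replicate i p11 ++ A.map (tauF p01 p11) ++ List.replicate j p01) := by
  simp [listValue]

lemma listValue_affine (r : ℕ) (l₁ l₂ : List ℝ) (x a b : ℝ) :
    listValue K p01 p11 β r (l₁ ++ (x * a + (1 - x) * b) :: l₂) =
      x * listValue K p01 p11 β r (l₁ ++ a :: l₂) +
        (1 - x) * listValue K p01 p11 β r (l₁ ++ b :: l₂) := by
  induction r generalizing l₁ l₂ x a b with
  | zero =>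
    rcases le_or_gt K l₁.length with h | h
    · simp only [listValue, List.take_append_of_le_length h]; ring
    · obtain ⟨d, rfl⟩ := Nat.exists_eq_add_of_lt h
      simp only [listValue, add_assoc, List.take_length_add_append, List.take_succ_cons,
        List.sum_append, List.sum_cons]
      ring
  | succ r ih =>
    rcases le_or_gt K l₁.length with h | h
    · simp only [listValue, List.take_append_of_le_length h, List.drop_append_of_le_length h,
        List.map_append, List.map_cons, tauF_affine]
      have key : ∀ i j, listValue K p01 p11 β r (List.replicate i p11 ++
          (List.map (tauF p01 p11) (List.drop K l₁) ++
            (x * tauF p01 p11 a + (1 - x) * tauF p01 p11 b) ::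
              List.map (tauF p01 p11) l₂) ++ List.replicate j p01) =
          x * listValue K p01 p11 β r (List.replicate i p11 ++
            (List.map (tauF p01 p11) (List.drop K l₁) ++ tauF p01 p11 a ::
              List.map (tauF p01 p11) l₂) ++ List.replicate j p01) +
          (1 - x) * listValue K p01 p11 β r (List.replicate i p11 ++
            (List.map (tauF p01 p11) (List.drop K l₁) ++ tauF p01 p11 b ::
              List.map (tauF p01 p11) l₂) ++ List.replicate j p01) := by
        intro i j
        have := ih (List.replicate i p11 ++ List.map (tauF p01 p11) (List.drop K l₁))
          (List.map (tauF p01 p11) l₂ ++ List.replicate j p01) x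
          (tauF p01 p11 a) (tauF p01 p11 b)
        simpa only [List.append_assoc, List.cons_append] using this
      simp only [key]
      rw [bernoulliExp_add_mul]
      ring
    · obtain ⟨d, rfl⟩ := Nat.exists_eq_add_of_lt h
      simp only [listValue, add_assoc, List.take_length_add_append, List.take_succ_cons,
        List.drop_length_add_append, List.drop_succ_cons,
        List.sum_append, List.sum_cons, bernoulliExp_affine]
      ring

lemma listValue_split (r : ℕ) (l₁ l₂ : List ℝ) (x : ℝ) :
    listValue K p01 p11 β r (l₁ ++ x :: l₂) =
      x * listValue K p01 p11 β r (l₁ ++ 1 :: l₂) +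
        (1 - x) * listValue K p01 p11 β r (l₁ ++ 0 :: l₂) := by
  simpa using listValue_affine (K := K) (p01 := p01) (p11 := p11) (β := β) r l₁ l₂ x 1 0

variable (K p01 p11 β) in
/-- Swapping two adjacent beliefs into decreasing order does not decrease the value. -/
def SwapLe (r : ℕ) : Prop :=
  ∀ (l₁ l₂ : List ℝ) (x y : ℝ), (∀ z ∈ l₁ ++ x :: y :: l₂, z ∈ Set.Icc (0 : ℝ) 1) → y ≤ x →
    listValue K p01 p11 β r (l₁ ++ y :: x :: l₂) ≤ listValue K p01 p11 β r (l₁ ++ x :: y :: l₂)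

variable (K p01 p11 β) in
/-- Moving the first belief to the end gains at most one. -/
def RotateLe (r : ℕ) : Prop :=
  ∀ (l : List ℝ) (x : ℝ), (∀ z ∈ x :: l, z ∈ Set.Icc (0 : ℝ) 1) →
    listValue K p01 p11 β r (l ++ [x]) ≤ 1 + listValue K p01 p11 β r (x :: l)

lemma SwapLe.move_front {r : ℕ} (h : SwapLe K p01 p11 β r) (P l R : List ℝ) (c : ℝ)
    (hI : ∀ z ∈ P ++ c :: (l ++ R), z ∈ Set.Icc (0 : ℝ) 1) (hc : ∀ z ∈ l, z ≤ c) :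
    listValue K p01 p11 β r (P ++ (l ++ c :: R)) ≤
      listValue K p01 p11 β r (P ++ c :: (l ++ R)) := by
  induction l generalizing P with
  | nil => rfl
  | cons z l ih =>
    have h₁ := ih (P ++ [z]) (fun w hw => hI w (by simp at hw ⊢; tauto))
      (fun w hw => hc w (by simp [hw]))
    have h₂ := h P (l ++ R) c z (fun w hw => hI w (by simpa using hw)) (hc z (by simp))
    simp only [List.append_assoc, List.cons_append, List.nil_append] at h₁ h₂ ⊢
    exact h₁.trans h₂

lemma SwapLe.move_back {r : ℕ} (h : SwapLe K p01 p11 β r) (P l R : List ℝ) (c : ℝ)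
    (hI : ∀ z ∈ P ++ c :: (l ++ R), z ∈ Set.Icc (0 : ℝ) 1) (hc : ∀ z ∈ l, c ≤ z) :
    listValue K p01 p11 β r (P ++ c :: (l ++ R)) ≤
      listValue K p01 p11 β r (P ++ (l ++ c :: R)) := by
  induction l generalizing P with
  | nil => rfl
  | cons z l ih =>
    have h₁ := ih (P ++ [z]) (fun w hw => hI w (by simp at hw ⊢; tauto))
      (fun w hw => hc w (by simp [hw]))
    have h₂ := h P (l ++ R) z c (fun w hw => hI w (by simp at hw ⊢; tauto)) (hc z (by simp))
    simp only [List.append_assoc, List.cons_append, List.nil_append] at h₁ h₂ ⊢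
    exact h₂.trans h₁

lemma SwapLe.le_of_perm {r : ℕ} (h : SwapLe K p01 p11 β r) (P : List ℝ) {l l' : List ℝ}
    (hp : l.Perm l') (hs : l'.Pairwise (· ≥ ·))
    (hI : ∀ z ∈ P ++ l', z ∈ Set.Icc (0 : ℝ) 1) :
    listValue K p01 p11 β r (P ++ l) ≤ listValue K p01 p11 β r (P ++ l') := by
  induction l' generalizing P l with
  | nil => rw [hp.eq_nil]
  | cons c t ih =>
    obtain ⟨l₁, l₂, rfl⟩ := List.append_of_mem (hp.symm.subset (by simp : c ∈ c :: t))
    have hp' : (l₁ ++ l₂).Perm t := (List.perm_middle.symm.trans hp).cons_inv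
    rw [List.pairwise_cons] at hs
    have h₁ := h.move_front P l₁ l₂ c
      (fun z hz => hI z (by
        have := hp'.mem_iff (a := z)
        simp only [List.mem_append, List.mem_cons] at hz this ⊢; tauto))
      (fun z hz => hs.1 z (hp'.subset (by simp [hz])))
    have h₂ := ih (P ++ [c]) hp' hs.2 (by simpa using hI)
    simp only [List.append_assoc, List.cons_append, List.nil_append] at h₁ h₂ ⊢
    exact h₁.trans h₂

lemma SwapLe.end_le {r : ℕ} (hA : SwapLe K p01 p11 β r) (hB : RotateLe K p01 p11 β r)
    (l R : List ℝ) (c : ℝ) (hI : ∀ z ∈ c :: (l ++ R), z ∈ Set.Icc (0 : ℝ) 1)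
    (hc : ∀ z ∈ l, c ≤ z) :
    listValue K p01 p11 β r (l ++ R ++ [c]) ≤ 1 + listValue K p01 p11 β r (l ++ c :: R) := by
  have h₁ := hB (l ++ R) c hI
  have h₂ := hA.move_back [] l R c hI hc
  simp only [List.nil_append] at h₂
  linarith

lemma mem_next (h0 : p01 ∈ Set.Icc (0 : ℝ) 1) (h1 : p11 ∈ Set.Icc (0 : ℝ) 1) {A : List ℝ}
    (hA : ∀ z ∈ A, z ∈ Set.Icc (0 : ℝ) 1) (i j : ℕ) :
    ∀ z ∈ List.replicate i p11 ++ A.map (tauF p01 p11) ++ List.replicate j p01,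
      z ∈ Set.Icc (0 : ℝ) 1 := by
  intro z hz
  simp only [List.mem_append, List.mem_replicate, List.mem_map] at hz
  rcases hz with (⟨-, rfl⟩ | ⟨w, hw, rfl⟩) | ⟨-, rfl⟩
  exacts [h1, tauF_mem h0 h1 (hA w hw), h0]

lemma SwapLe.next_le {r : ℕ} (hA : SwapLe K p01 p11 β r) (hB : RotateLe K p01 p11 β r)
    (h0 : p01 ∈ Set.Icc (0 : ℝ) 1) (h1 : p11 ∈ Set.Icc (0 : ℝ) 1) (hord : p01 ≤ p11)
    {A : List ℝ} (hI : ∀ z ∈ A, z ∈ Set.Icc (0 : ℝ) 1) (i j : ℕ) :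
    listValue K p01 p11 β r (List.replicate i p11 ++ A.map (tauF p01 p11) ++
      List.replicate (j + 1) p01) ≤
    1 + listValue K p01 p11 β r (List.replicate i p11 ++ p01 :: A.map (tauF p01 p11) ++
      List.replicate j p01) := by
  have key := hA.end_le hB (List.replicate i p11)
    (A.map (tauF p01 p11) ++ List.replicate j p01) p01
    (fun z hz => by
      rcases List.mem_cons.1 hz with rfl | hz
      · exact h0
      · exact mem_next h0 h1 hI i j z (by simpa using hz))
    (fun z hz => by rw [List.eq_of_mem_replicate hz]; exact hord)
  simpa [List.replicate_succ', List.append_assoc] using key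

lemma SwapLe.next_success_le {r : ℕ} (hA : SwapLe K p01 p11 β r)
    (h0 : p01 ∈ Set.Icc (0 : ℝ) 1) (h1 : p11 ∈ Set.Icc (0 : ℝ) 1) (hord : p01 ≤ p11)
    {A : List ℝ} (hI : ∀ z ∈ A, z ∈ Set.Icc (0 : ℝ) 1) (i j : ℕ) :
    listValue K p01 p11 β r (List.replicate i p11 ++ (A.map (tauF p01 p11) ++ [p11]) ++
      List.replicate j p01) ≤
    listValue K p01 p11 β r (List.replicate (i + 1) p11 ++ A.map (tauF p01 p11) ++
      List.replicate j p01) := by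
  have key := hA.move_front (List.replicate i p11) (A.map (tauF p01 p11))
    (List.replicate j p01) p11
    (fun z hz => mem_next h0 h1 hI (i + 1) j z (by
      simp [List.replicate_succ'] at hz ⊢; tauto))
    (fun z hz => by
      obtain ⟨w, hw, rfl⟩ := List.mem_map.1 hz
      exact tauF_le hord (hI w hw))
  simpa [List.replicate_succ', List.append_assoc] using key

lemma swapLe_zero : SwapLe K p01 p11 β 0 := by
  intro l₁ l₂ x y _ hxy
  rcases lt_trichotomy (l₁.length + 1) K with h | h | h
  · obtain ⟨d, rfl⟩ : ∃ d, K = l₁.length + (d + 1 + 1) := ⟨K - l₁.length - 2, by omega⟩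
    simp only [listValue, List.take_length_add_append, List.take_succ_cons, List.sum_append,
      List.sum_cons]
    linarith
  · subst h
    simp only [listValue, List.take_length_add_append, List.take_succ_cons,
      List.sum_append, List.sum_cons]
    simpa using hxy
  · have h : K ≤ l₁.length := by omega
    simp only [listValue, List.take_append_of_le_length h, le_refl]

lemma swapLe_succ (h0 : p01 ∈ Set.Icc (0 : ℝ) 1) (h1 : p11 ∈ Set.Icc (0 : ℝ) 1)
    (hβ : β ∈ Set.Icc (0 : ℝ) 1) (hord : p01 ≤ p11) {r : ℕ}
    (hA : SwapLe K p01 p11 β r) (hB : RotateLe K p01 p11 β r) :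
    SwapLe K p01 p11 β (r + 1) := by
  intro l₁ l₂ x y hI hxy
  rcases lt_trichotomy (l₁.length + 1) K with h | h | h
  · obtain ⟨d, rfl⟩ : ∃ d, K = l₁.length + (d + 1 + 1) := ⟨K - l₁.length - 2, by omega⟩
    refine (listValue_congr ?_ ?_ _).le
    · simp only [List.take_length_add_append, List.take_succ_cons]
      exact (List.Perm.swap _ _ _).append_left _
    · simp only [List.drop_length_add_append, List.drop_succ_cons]
  · have hI₁ : ∀ z ∈ l₁, z ∈ Set.Icc (0 : ℝ) 1 := fun z hz => hI z (by simp [hz])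
    have hI₂ : ∀ z ∈ l₂, z ∈ Set.Icc (0 : ℝ) 1 := fun z hz => hI z (by simp [hz])
    have corner : listValue K p01 p11 β (r + 1) (l₁ ++ 0 :: 1 :: l₂) ≤
        listValue K p01 p11 β (r + 1) (l₁ ++ 1 :: 0 :: l₂) := by
      subst h
      simp only [listValue, List.take_length_add_append, List.drop_length_add_append,
        List.take_succ_cons, List.drop_succ_cons, List.take_zero, List.drop_zero,
        bernoulliExp_perm (List.perm_append_singleton _ l₁)]
      simp only [bernoulliExp, List.sum_append, List.sum_singleton, List.map_cons, tauF_one,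
        tauF_zero, one_mul, zero_mul, sub_self, sub_zero, add_zero, zero_add]
      rw [add_assoc]
      refine add_le_add_right (mul_bernoulliExp_le hI₁ fun i j => ?_) _
      have key := hA.next_le hB h0 h1 hord hI₂ (i + 1) j
      have e : List.replicate i p11 ++ p11 :: List.map (tauF p01 p11) l₂ ++
          List.replicate (j + 1) p01 = List.replicate (i + 1) p11 ++
            l₂.map (tauF p01 p11) ++ List.replicate (j + 1) p01 := by
        simp [List.replicate_succ', List.append_assoc]
      rw [e]
      nlinarith [mul_le_mul_of_nonneg_left key hβ.1, hβ.2]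
    have s₁ := listValue_split (K := K) (p01 := p01) (p11 := p11) (β := β) (r + 1)
      l₁ (y :: l₂) x
    have s₂ := listValue_split (K := K) (p01 := p01) (p11 := p11) (β := β) (r + 1)
      l₁ (x :: l₂) y
    have t : ∀ a b : ℝ, listValue K p01 p11 β (r + 1) (l₁ ++ a :: b :: l₂) =
        b * listValue K p01 p11 β (r + 1) (l₁ ++ a :: 1 :: l₂) +
        (1 - b) * listValue K p01 p11 β (r + 1) (l₁ ++ a :: 0 :: l₂) := by
      intro a b
      simpa using listValue_split (K := K) (p01 := p01) (p11 := p11) (β := β) (r + 1)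
        (l₁ ++ [a]) l₂ b
    rw [s₁, s₂, t 1 y, t 0 y, t 1 x, t 0 x]
    nlinarith [mul_le_mul_of_nonneg_left corner (sub_nonneg.2 hxy)]
  · have h : K ≤ l₁.length := by omega
    have hI₁ : ∀ z ∈ l₁.take K, z ∈ Set.Icc (0 : ℝ) 1 :=
      fun z hz => hI z (by simp [List.mem_of_mem_take hz])
    simp only [listValue, List.take_append_of_le_length h, List.drop_append_of_le_length h]
    refine add_le_add_right (mul_le_mul_of_nonneg_left (bernoulliExp_mono hI₁ fun i j => ?_) hβ.1) _
    have key := hA (List.replicate i p11 ++ (l₁.drop K).map (tauF p01 p11))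
      (l₂.map (tauF p01 p11) ++ List.replicate j p01) (tauF p01 p11 x) (tauF p01 p11 y)
      (fun z hz => mem_next h0 h1 (A := l₁.drop K ++ x :: y :: l₂)
        (fun w hw => hI w (by
          have := List.mem_of_mem_drop (l := l₁) (i := K) (a := w)
          simp only [List.mem_append] at hw ⊢; tauto)) i j z (by simpa using hz))
      (tauF_mono hord hxy)
    simpa using key

/-- A function that is affine in each of two variables is nonnegative on the unit square if it is
nonnegative at the corners. -/
lemma nonneg_of_biaffine {f : ℝ → ℝ → ℝ} (hx : ∀ x y, f x y = x * f 1 y + (1 - x) * f 0 y)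
    (hy : ∀ x y, f x y = y * f x 1 + (1 - y) * f x 0)
    (h00 : 0 ≤ f 0 0) (h01 : 0 ≤ f 0 1) (h10 : 0 ≤ f 1 0) (h11 : 0 ≤ f 1 1) {x y : ℝ}
    (hx' : x ∈ Set.Icc (0 : ℝ) 1) (hy' : y ∈ Set.Icc (0 : ℝ) 1) : 0 ≤ f x y := by
  have hx₁ : 0 ≤ 1 - x := sub_nonneg.2 hx'.2
  have hy₁ : 0 ≤ 1 - y := sub_nonneg.2 hy'.2
  have hx₀ := hx'.1
  have hy₀ := hy'.1
  rw [hx, hy 1, hy 0]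
  positivity

lemma rotateLe_of_length_lt {r : ℕ} {l : List ℝ} (x : ℝ) (h : l.length < K) :
    listValue K p01 p11 β r (l ++ [x]) ≤ 1 + listValue K p01 p11 β r (x :: l) := by
  have : listValue K p01 p11 β r (l ++ [x]) = listValue K p01 p11 β r (x :: l) := by
    apply listValue_congr
    · rw [List.take_of_length_le (by simpa using h), List.take_of_length_le (by simpa using h)]
      exact List.perm_append_singleton _ _
    · rw [List.drop_of_length_le (by simpa using h), List.drop_of_length_le (by simpa using h)]
  linarith

lemma exists_eq_append_cons {l : List ℝ} (hK : 1 ≤ K) (h : K ≤ l.length) :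
    ∃ u y A, l = u ++ y :: A ∧ u.length + 1 = K := by
  refine ⟨l.take (K - 1), l[K - 1], l.drop (K - 1 + 1), ?_, ?_⟩
  · rw [← List.drop_eq_getElem_cons, List.take_append_drop]
  · rw [List.length_take]; omega

lemma rotateLe_zero (hK : 1 ≤ K) : RotateLe K p01 p11 β 0 := by
  intro l x hI
  rcases lt_or_ge l.length K with h | h
  · exact rotateLe_of_length_lt x h
  · obtain ⟨u, y, A, rfl, rfl⟩ := exists_eq_append_cons hK h
    have hx := hI x (by simp)
    have hy := hI y (by simp)
    simp only [listValue, List.append_assoc, List.take_length_add_append, List.cons_append,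
      List.take_succ_cons, List.take_zero, List.sum_append, List.sum_cons, List.take_left,
      List.sum_nil]
    linarith [hx.1, hy.2]

lemma rotateLe_succ (hK : 1 ≤ K) (h0 : p01 ∈ Set.Icc (0 : ℝ) 1)
    (h1 : p11 ∈ Set.Icc (0 : ℝ) 1) (hβ : β ∈ Set.Icc (0 : ℝ) 1) (hord : p01 ≤ p11) {r : ℕ}
    (hA : SwapLe K p01 p11 β r) (hB : RotateLe K p01 p11 β r) :
    RotateLe K p01 p11 β (r + 1) := by
  intro l x hI
  rcases lt_or_ge l.length K with h | h
  · exact rotateLe_of_length_lt x h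
  obtain ⟨u, y, A, rfl, hu⟩ := exists_eq_append_cons hK h
  have hIu : ∀ z ∈ u, z ∈ Set.Icc (0 : ℝ) 1 := fun z hz => hI z (by simp [hz])
  have hIA : ∀ z ∈ A, z ∈ Set.Icc (0 : ℝ) 1 := fun z hz => hI z (by simp [hz])
  have hIτ : ∀ z ∈ A.map (tauF p01 p11), z ∈ Set.Icc (0 : ℝ) 1 := fun z hz =>
    mem_next h0 h1 hIA 0 0 z (by simpa using hz)
  have first : ∀ x y, listValue K p01 p11 β (r + 1) (x :: (u ++ y :: A)) =
      (x + u.sum) + β * bernoulliExp (x :: u) fun i j => listValue K p01 p11 β r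
        (List.replicate i p11 ++ (y :: A).map (tauF p01 p11) ++ List.replicate j p01) := by
    intro x y
    subst hu
    exact listValue_succ_append (x :: u) (y :: A) r
  have second : ∀ x y, listValue K p01 p11 β (r + 1) (u ++ y :: A ++ [x]) =
      (y + u.sum) + β * bernoulliExp (y :: u) fun i j => listValue K p01 p11 β r
        (List.replicate i p11 ++ (A ++ [x]).map (tauF p01 p11) ++ List.replicate j p01) := by
    intro x y
    subst hu
    rw [← List.sum_cons, ← (List.perm_append_singleton y u).sum_eq,
      ← bernoulliExp_perm (List.perm_append_singleton y u)]
    have := listValue_succ_append (p01 := p01) (p11 := p11) (β := β) (u ++ [y]) (A ++ [x]) r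
    simpa using this
  suffices 0 ≤ 1 + listValue K p01 p11 β (r + 1) (x :: (u ++ y :: A)) -
      listValue K p01 p11 β (r + 1) (u ++ y :: A ++ [x]) by linarith
  refine nonneg_of_biaffine (f := fun x y => 1 + listValue K p01 p11 β (r + 1) (x :: (u ++ y :: A)) -
      listValue K p01 p11 β (r + 1) (u ++ y :: A ++ [x])) ?_ ?_ ?_ ?_ ?_ ?_
    (hI x (by simp)) (hI y (by simp))
  · intro x y
    have s₁ := listValue_split (K := K) (p01 := p01) (p11 := p11) (β := β) (r + 1)
      [] (u ++ y :: A) x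
    have s₂ := listValue_split (K := K) (p01 := p01) (p11 := p11) (β := β) (r + 1)
      (u ++ y :: A) [] x
    simp only [List.nil_append] at s₁
    simp only [s₁, s₂]; ring
  · intro x y
    have s₁ := listValue_split (K := K) (p01 := p01) (p11 := p11) (β := β) (r + 1)
      (x :: u) A y
    have s₂ := listValue_split (K := K) (p01 := p01) (p11 := p11) (β := β) (r + 1)
      u (A ++ [x]) y
    simp only [List.cons_append] at s₁
    simp only [List.append_assoc, List.cons_append, s₁, s₂]; ring
  all_goals
    simp only [first, second]
    simp only [bernoulliExp, List.map_append, List.map_cons, List.map_nil, tauF_one,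
      tauF_zero, one_mul, zero_mul, sub_self, sub_zero, add_zero, zero_add]
  · have := mul_bernoulliExp_le (c := 1) (β := β) hIu fun i j =>
      show β * listValue K p01 p11 β r (List.replicate i p11 ++
          (A.map (tauF p01 p11) ++ [p01]) ++ List.replicate (j + 1) p01) ≤
        1 + β * listValue K p01 p11 β r (List.replicate i p11 ++
          p01 :: A.map (tauF p01 p11) ++ List.replicate (j + 1) p01) by
      have e : List.replicate i p11 ++ (A.map (tauF p01 p11) ++ [p01]) ++
          List.replicate (j + 1) p01 = List.replicate i p11 ++ A.map (tauF p01 p11) ++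
          List.replicate (j + 1 + 1) p01 := by
        simp [List.replicate_succ, List.append_assoc]
      rw [e]
      nlinarith [mul_le_mul_of_nonneg_left (hA.next_le hB h0 h1 hord hIA i (j + 1)) hβ.1, hβ.2]
    linarith
  · have e : ∀ i j, List.replicate (i + 1) p11 ++ (A.map (tauF p01 p11) ++ [p01]) ++
        List.replicate j p01 = List.replicate i p11 ++ p11 :: A.map (tauF p01 p11) ++
        List.replicate (j + 1) p01 := by
      intro i j
      rw [List.replicate_succ', List.replicate_succ]
      simp only [List.append_assoc, List.cons_append, List.nil_append]
    simp only [e]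
    linarith
  · have := mul_bernoulliExp_le (c := 2) (β := β) hIu fun i j =>
      show β * listValue K p01 p11 β r (List.replicate i p11 ++
          (A.map (tauF p01 p11) ++ [p11]) ++ List.replicate (j + 1) p01) ≤
        2 + β * listValue K p01 p11 β r (List.replicate (i + 1) p11 ++
          p01 :: A.map (tauF p01 p11) ++ List.replicate j p01) by
      have h₁ := hA.next_success_le h0 h1 hord hIA i (j + 1)
      have h₂ := hA.next_le hB h0 h1 hord hIA (i + 1) j
      nlinarith [mul_le_mul_of_nonneg_left (h₁.trans h₂) hβ.1, hβ.2]
    linarith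
  · have := mul_bernoulliExp_le (c := 1) (β := β) hIu fun i j =>
      show β * listValue K p01 p11 β r (List.replicate (i + 1) p11 ++
          (A.map (tauF p01 p11) ++ [p11]) ++ List.replicate j p01) ≤
        1 + β * listValue K p01 p11 β r (List.replicate (i + 1) p11 ++
          p11 :: A.map (tauF p01 p11) ++ List.replicate j p01) by
      have h₁ := hA.next_success_le h0 h1 hord hIA (i + 1) j
      have e : List.replicate (i + 1) p11 ++ p11 :: A.map (tauF p01 p11) ++
          List.replicate j p01 = List.replicate (i + 1 + 1) p11 ++ A.map (tauF p01 p11) ++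
          List.replicate j p01 := by
        rw [List.replicate_succ' (n := i + 1)]
        simp only [List.append_assoc, List.cons_append, List.nil_append]
      rw [e]
      linarith [mul_le_mul_of_nonneg_left h₁ hβ.1]
    linarith

lemma swapLe_and_rotateLe (hK : 1 ≤ K) (h0 : p01 ∈ Set.Icc (0 : ℝ) 1)
    (h1 : p11 ∈ Set.Icc (0 : ℝ) 1) (hβ : β ∈ Set.Icc (0 : ℝ) 1) (hord : p01 ≤ p11) (r : ℕ) :
    SwapLe K p01 p11 β r ∧ RotateLe K p01 p11 β r := by
  induction r with
  | zero => exact ⟨swapLe_zero, rotateLe_zero hK⟩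
  | succ r ih =>
    exact ⟨swapLe_succ h0 h1 hβ hord ih.1 ih.2, rotateLe_succ hK h0 h1 hβ hord ih.1 ih.2⟩

end listValue

/-- The entries of a multiset of reals in decreasing order. -/
noncomputable def descList (m : Multiset ℝ) : List ℝ := m.sort (· ≥ ·)

lemma coe_descList (m : Multiset ℝ) : (descList m : Multiset ℝ) = m := Multiset.sort_eq _ _

lemma descList_pairwise (m : Multiset ℝ) : (descList m).Pairwise (· ≥ ·) :=
  Multiset.pairwise_sort _ _

lemma mem_descList {m : Multiset ℝ} {x : ℝ} : x ∈ descList m ↔ x ∈ m := Multiset.mem_sort _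

lemma perm_descList {l : List ℝ} {m : Multiset ℝ} (h : (l : Multiset ℝ) = m) :
    l.Perm (descList m) := Multiset.coe_eq_coe.1 (h.trans (coe_descList m).symm)

lemma eq_descList {l : List ℝ} {m : Multiset ℝ} (h : (l : Multiset ℝ) = m)
    (hl : l.Pairwise (· ≥ ·)) : l = descList m :=
  (perm_descList h).eq_of_pairwise' hl (descList_pairwise m)

lemma sum_bool_eq_bernoulliExp (k : ℕ) (u : Fin k → ℝ) (f : ℕ → ℕ → ℝ) :
    ∑ s : Fin k → Bool, (∏ i, if s i then u i else 1 - u i) *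
      f (∑ i, if s i then 1 else 0) (∑ i, if s i then 0 else 1) =
    bernoulliExp (List.ofFn u) f := by
  induction k generalizing f with
  | zero => simp [bernoulliExp]
  | succ k ih =>
    rw [← (Fin.consEquiv fun _ : Fin (k + 1) => Bool).sum_comp, Fintype.sum_prod_type]
    simp only [Fin.consEquiv_apply, Fin.prod_univ_succ, Fin.sum_univ_succ, Fin.cons_zero,
      Fin.cons_succ, Fintype.sum_bool, List.ofFn_succ, bernoulliExp, if_true,
      Bool.false_eq_true, if_false, zero_add, ← ih, Finset.mul_sum, mul_assoc, add_comm 1]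

lemma sum_obsProb {n : ℕ} (ω : Fin n → ℝ) (a : Finset (Fin n)) (f : ℕ → ℕ → ℝ) :
    ∑ s : {i // i ∈ a} → Bool, obsProb ω a s *
      f (∑ i, if s i then 1 else 0) (∑ i, if s i then 0 else 1) =
    bernoulliExp (descList (a.val.map ω)) f := by
  let e := a.equivFin
  have hl : (List.ofFn fun i => ω (e.symm i)).Perm (descList (a.val.map ω)) := by
    apply perm_descList
    rw [← Fin.univ_val_map]
    calc (univ : Finset (Fin a.card)).val.map (fun i => ω (e.symm i))
        = (univ.val.map e.symm).map fun i => ω i.1 := by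
          rw [Multiset.map_map]; rfl
      _ = a.val.map ω := by
        rw [Multiset.map_univ_val_equiv, Finset.univ_eq_attach, Finset.attach_val]
        exact Multiset.attach_map_val' a.val ω
  rw [← bernoulliExp_perm hl, ← sum_bool_eq_bernoulliExp,
    ← (e.arrowCongr (Equiv.refl Bool)).sum_comp]
  refine Finset.sum_congr rfl fun s _ => ?_
  simp only [obsProb, Equiv.arrowCongr_apply, Equiv.coe_refl, Function.comp, id]
  rw [← e.symm.prod_comp, ← e.symm.sum_comp, ← e.symm.sum_comp]

lemma map_ite_eq_replicate {ι : Type*} (S : Finset ι) (s : ι → Bool) (x y : ℝ) :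
    S.val.map (fun i => if s i then x else y) =
      Multiset.replicate (∑ i ∈ S, if s i then 1 else 0) x +
        Multiset.replicate (∑ i ∈ S, if s i then 0 else 1) y := by
  classical
  induction S using Finset.induction_on with
  | empty => simp
  | insert i S hi ih =>
    rw [Finset.insert_val_of_notMem hi, Multiset.map_cons, ih, Finset.sum_insert hi,
      Finset.sum_insert hi]
    cases s i <;> simp [add_comm 1, Multiset.replicate_succ]

lemma map_univ_eq_add_compl {n : ℕ} (f : Fin n → ℝ) (a : Finset (Fin n)) :
    (univ : Finset (Fin n)).val.map f = a.val.map f + aᶜ.val.map f := by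
  rw [← Multiset.map_add, ← Finset.disjUnion_val a aᶜ disjoint_compl_right,
    Finset.disjUnion_eq_union, Finset.union_compl]

section value

variable {n k : ℕ} {hk : k ≤ n} {p01 p11 β : ℝ}

lemma nextState_mem (h0 : p01 ∈ Set.Icc (0 : ℝ) 1) (h1 : p11 ∈ Set.Icc (0 : ℝ) 1)
    {ω : Fin n → ℝ} (hω : ∀ i, ω i ∈ Set.Icc (0 : ℝ) 1) (a : Finset (Fin n))
    (s : {i // i ∈ a} → Bool) (i : Fin n) :
    nextState p01 p11 ω a s i ∈ Set.Icc (0 : ℝ) 1 := by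
  unfold nextState
  split_ifs
  exacts [h1, h0, tauF_mem h0 h1 (hω i)]

lemma descList_nextState (hord : p01 ≤ p11)
    {ω : Fin n → ℝ} (hω : ∀ i, ω i ∈ Set.Icc (0 : ℝ) 1) (a : Finset (Fin n))
    (s : {i // i ∈ a} → Bool) :
    descList ((univ : Finset (Fin n)).val.map (nextState p01 p11 ω a s)) =
      List.replicate (∑ i, if s i then 1 else 0) p11 ++
        (descList (aᶜ.val.map ω)).map (tauF p01 p11) ++
        List.replicate (∑ i, if s i then 0 else 1) p01 := by
  symm
  have hI : ∀ z ∈ descList (aᶜ.val.map ω), z ∈ Set.Icc (0 : ℝ) 1 := by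
    intro z hz
    obtain ⟨i, -, rfl⟩ := Multiset.mem_map.1 (mem_descList.1 hz)
    exact hω i
  apply eq_descList
  · have h₁ : aᶜ.val.map (nextState p01 p11 ω a s) = (aᶜ.val.map ω).map (tauF p01 p11) := by
      rw [Multiset.map_map]
      refine Multiset.map_congr rfl fun i hi => ?_
      have : i ∉ a := Finset.mem_compl.1 hi
      simp [nextState, this]
    have h₂ : a.val.map (nextState p01 p11 ω a s) =
        (univ : Finset {i // i ∈ a}).val.map (fun i => if s i then p11 else p01) := by
      rw [Finset.univ_eq_attach, Finset.attach_val,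
        ← Multiset.attach_map_val' a.val (nextState p01 p11 ω a s)]
      refine Multiset.map_congr rfl fun i _ => ?_
      have : i.1 ∈ a := i.2
      simp [nextState, this]
    rw [map_univ_eq_add_compl _ a, h₁, h₂, map_ite_eq_replicate]
    simp only [← Multiset.coe_add, ← Multiset.map_coe, coe_descList, Multiset.coe_replicate]
    exact add_right_comm _ _ _
  · rw [List.pairwise_append, List.pairwise_append, List.pairwise_map]
    refine ⟨⟨List.pairwise_replicate.2 (.inr le_rfl), ?_, ?_⟩,
      List.pairwise_replicate.2 (.inr le_rfl), ?_⟩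
    · exact (descList_pairwise _).imp fun h => tauF_mono hord h
    · intro x hx y hy
      obtain ⟨w, hw, rfl⟩ := List.mem_map.1 hy
      rw [List.eq_of_mem_replicate hx]
      exact tauF_le hord (hI w hw)
    · intro x hx y hy
      rw [List.eq_of_mem_replicate hy]
      rcases List.mem_append.1 hx with hx | hx
      · rw [List.eq_of_mem_replicate hx]
        exact hord
      · obtain ⟨w, hw, rfl⟩ := List.mem_map.1 hx
        exact le_tauF hord (hI w hw)

lemma mem_actions {a : Finset (Fin n)} : a ∈ actions n k ↔ a.card = k := by
  simp [actions, Finset.mem_powersetCard]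

lemma Vval_eq_sup' (r : ℕ) (ω : Fin n → ℝ) : Vval n k hk p01 p11 β r ω =
    (actions n k).sup' (actions_nonempty hk) (Qval n k hk p01 p11 β r ω) := by
  cases r <;> rfl

/-- An action of maximal immediate reward is greedy. -/
lemma exists_greedy (hk : k ≤ n) (ω : Fin n → ℝ) :
    ∃ g ∈ actions n k, ∀ i ∈ g, ∀ j ∉ g, ω j ≤ ω i := by
  obtain ⟨g, hg, hmax⟩ :=
    (actions n k).exists_max_image (fun a => ∑ i ∈ a, ω i) (actions_nonempty hk)
  refine ⟨g, hg, fun i hi j hj => ?_⟩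
  have hj' : j ∉ g.erase i := fun h => hj (Finset.mem_of_mem_erase h)
  have h := hmax (insert j (g.erase i)) (by
    rw [mem_actions] at hg ⊢
    rw [Finset.card_insert_of_notMem hj', Finset.card_erase_add_one hi, hg])
  simp only [Finset.sum_insert hj'] at h
  linarith [Finset.add_sum_erase g ω hi]

lemma descList_append_of_greedy {ω : Fin n → ℝ} {g : Finset (Fin n)}
    (hg : ∀ i ∈ g, ∀ j ∉ g, ω j ≤ ω i) :
    descList (g.val.map ω) ++ descList (gᶜ.val.map ω) =
      descList ((univ : Finset (Fin n)).val.map ω) := by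
  apply eq_descList
  · rw [← Multiset.coe_add, coe_descList, coe_descList, map_univ_eq_add_compl ω g]
  · rw [List.pairwise_append]
    refine ⟨descList_pairwise _, descList_pairwise _, fun x hx y hy => ?_⟩
    obtain ⟨i, hi, rfl⟩ := Multiset.mem_map.1 (mem_descList.1 hx)
    obtain ⟨j, hj, rfl⟩ := Multiset.mem_map.1 (mem_descList.1 hy)
    exact hg i hi j (Finset.mem_compl.1 hj)

lemma length_descList_map {ω : Fin n → ℝ} {a : Finset (Fin n)} (ha : a ∈ actions n k) :
    (descList (a.val.map ω)).length = k := by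
  rw [mem_actions] at ha
  simp [descList, ha]

lemma Qval_zero_eq (ω : Fin n → ℝ) {a : Finset (Fin n)} (ha : a ∈ actions n k) :
    Qval n k hk p01 p11 β 0 ω a = listValue k p01 p11 β 0
      (descList (a.val.map ω) ++ descList (aᶜ.val.map ω)) := by
  have h := listValue_zero_append (p01 := p01) (p11 := p11) (β := β)
    (descList (a.val.map ω)) (descList (aᶜ.val.map ω))
  rw [length_descList_map ha] at h
  rw [h, ← Multiset.sum_coe, coe_descList]
  rfl

lemma Qval_succ_eq (h0 : p01 ∈ Set.Icc (0 : ℝ) 1) (h1 : p11 ∈ Set.Icc (0 : ℝ) 1)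
    (hord : p01 ≤ p11) {r : ℕ}
    (hV : ∀ ω : Fin n → ℝ, (∀ i, ω i ∈ Set.Icc (0 : ℝ) 1) → Vval n k hk p01 p11 β r ω =
      listValue k p01 p11 β r (descList ((univ : Finset (Fin n)).val.map ω)))
    {ω : Fin n → ℝ} (hω : ∀ i, ω i ∈ Set.Icc (0 : ℝ) 1)
    {a : Finset (Fin n)} (ha : a ∈ actions n k) :
    Qval n k hk p01 p11 β (r + 1) ω a = listValue k p01 p11 β (r + 1)
      (descList (a.val.map ω) ++ descList (aᶜ.val.map ω)) := by
  have h := listValue_succ_append (p01 := p01) (p11 := p11) (β := β)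
    (descList (a.val.map ω)) (descList (aᶜ.val.map ω)) r
  rw [length_descList_map ha] at h
  rw [h, ← Multiset.sum_coe, coe_descList, ← sum_obsProb]
  simp only [Qval, hV _ (nextState_mem h0 h1 hω a _), descList_nextState hord hω]
  rfl

lemma listValue_append_compl_le (hk1 : 1 ≤ k) (h0 : p01 ∈ Set.Icc (0 : ℝ) 1)
    (h1 : p11 ∈ Set.Icc (0 : ℝ) 1) (hβ : β ∈ Set.Icc (0 : ℝ) 1) (hord : p01 ≤ p11) {r : ℕ}
    {ω : Fin n → ℝ} (hω : ∀ i, ω i ∈ Set.Icc (0 : ℝ) 1) (a : Finset (Fin n)) :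
    listValue k p01 p11 β r (descList (a.val.map ω) ++ descList (aᶜ.val.map ω)) ≤
      listValue k p01 p11 β r (descList ((univ : Finset (Fin n)).val.map ω)) := by
  refine (swapLe_and_rotateLe hk1 h0 h1 hβ hord r).1.le_of_perm []
    (l := descList (a.val.map ω) ++ descList (aᶜ.val.map ω))
    (l' := descList ((univ : Finset (Fin n)).val.map ω)) (perm_descList ?_)
    (descList_pairwise _) fun z hz => ?_
  · rw [← Multiset.coe_add, coe_descList, coe_descList, map_univ_eq_add_compl ω a]
  · obtain ⟨i, -, rfl⟩ := Multiset.mem_map.1 (mem_descList.1 (List.nil_append _ ▸ hz))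
    exact hω i

lemma Vval_eq_listValue_of_Qval_eq (hk1 : 1 ≤ k) (h0 : p01 ∈ Set.Icc (0 : ℝ) 1)
    (h1 : p11 ∈ Set.Icc (0 : ℝ) 1) (hβ : β ∈ Set.Icc (0 : ℝ) 1) (hord : p01 ≤ p11) {r : ℕ}
    {ω : Fin n → ℝ} (hω : ∀ i, ω i ∈ Set.Icc (0 : ℝ) 1)
    (hQ : ∀ a ∈ actions n k, Qval n k hk p01 p11 β r ω a = listValue k p01 p11 β r
      (descList (a.val.map ω) ++ descList (aᶜ.val.map ω))) :
    Vval n k hk p01 p11 β r ω =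
      listValue k p01 p11 β r (descList ((univ : Finset (Fin n)).val.map ω)) := by
  obtain ⟨g, hg, hgr⟩ := exists_greedy hk ω
  rw [Vval_eq_sup']
  apply le_antisymm
  · refine Finset.sup'_le _ _ fun a ha => ?_
    rw [hQ a ha]
    exact listValue_append_compl_le hk1 h0 h1 hβ hord hω a
  · rw [← descList_append_of_greedy hgr, ← hQ g hg]
    exact Finset.le_sup' _ hg

lemma Vval_eq_listValue (hk1 : 1 ≤ k) (h0 : p01 ∈ Set.Icc (0 : ℝ) 1)
    (h1 : p11 ∈ Set.Icc (0 : ℝ) 1) (hβ : β ∈ Set.Icc (0 : ℝ) 1) (hord : p01 ≤ p11) (r : ℕ)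
    {ω : Fin n → ℝ} (hω : ∀ i, ω i ∈ Set.Icc (0 : ℝ) 1) :
    Vval n k hk p01 p11 β r ω =
      listValue k p01 p11 β r (descList ((univ : Finset (Fin n)).val.map ω)) := by
  induction r generalizing ω with
  | zero => exact Vval_eq_listValue_of_Qval_eq hk1 h0 h1 hβ hord hω fun a ha => Qval_zero_eq ω ha
  | succ r ih =>
    exact Vval_eq_listValue_of_Qval_eq hk1 h0 h1 hβ hord hω fun a ha =>
      Qval_succ_eq h0 h1 hord (fun _ h => ih h) hω ha

lemma Qval_eq_listValue (hk1 : 1 ≤ k) (h0 : p01 ∈ Set.Icc (0 : ℝ) 1)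
    (h1 : p11 ∈ Set.Icc (0 : ℝ) 1) (hβ : β ∈ Set.Icc (0 : ℝ) 1) (hord : p01 ≤ p11) (r : ℕ)
    {ω : Fin n → ℝ} (hω : ∀ i, ω i ∈ Set.Icc (0 : ℝ) 1)
    {a : Finset (Fin n)} (ha : a ∈ actions n k) :
    Qval n k hk p01 p11 β r ω a = listValue k p01 p11 β r
      (descList (a.val.map ω) ++ descList (aᶜ.val.map ω)) := by
  cases r with
  | zero => exact Qval_zero_eq ω ha
  | succ r =>
    exact Qval_succ_eq h0 h1 hord
      (fun _ h => Vval_eq_listValue hk1 h0 h1 hβ hord r h) hω ha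

end value

/-- Under `p01 ≤ p11`, for every `t ∈ {1,…,T}` and every state
`ω ∈ [0,1]^n`, any greedy set `g` achieves the maximum in the DP recursion:
`Q_t(ω, g) ≥ Q_t(ω, a)` for every `a ⊆ {1,…,n}` with `|a| = k`, and
`V_t(ω) = Q_t(ω, g)`.  (Remaining-steps index: time `t` corresponds to `T - t`.) -/
theorem greedy_achieves_DP_maximum
    (n k T : ℕ) (hk1 : 1 ≤ k) (hkn : k ≤ n) (hT : 1 ≤ T)
    (p01 p11 β : ℝ)
    (hp01 : p01 ∈ Set.Icc (0:ℝ) 1) (hp11 : p11 ∈ Set.Icc (0:ℝ) 1)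
    (hβ : β ∈ Set.Icc (0:ℝ) 1) (hord : p01 ≤ p11)
    (t : ℕ) (ht1 : 1 ≤ t) (ht2 : t ≤ T)
    (ω : Fin n → ℝ) (hω : ∀ i, ω i ∈ Set.Icc (0:ℝ) 1)
    (g : Finset (Fin n)) (hg : g ∈ actions n k)
    (hgreedy : ∀ i ∈ g, ∀ j ∉ g, ω j ≤ ω i) :
    (∀ a ∈ actions n k,
        Qval n k hkn p01 p11 β (T - t) ω a ≤ Qval n k hkn p01 p11 β (T - t) ω g) ∧
      Vval n k hkn p01 p11 β (T - t) ω = Qval n k hkn p01 p11 β (T - t) ω g := by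
  have hgV : Vval n k hkn p01 p11 β (T - t) ω = Qval n k hkn p01 p11 β (T - t) ω g := by
    rw [Vval_eq_listValue hk1 hp01 hp11 hβ hord _ hω,
      Qval_eq_listValue hk1 hp01 hp11 hβ hord _ hω hg, descList_append_of_greedy hgreedy]
  refine ⟨fun a ha => ?_, hgV⟩
  rw [← hgV, Vval_eq_sup']
  exact Finset.le_sup' _ ha
end

section
/- Assume p01 ≤ p11 and β ∈ [0,1]. Then for every t ∈ {1,…,T} and every increasingly ordered vector 0 ≤ ω_1 ≤ ω_2 ≤ ⋯ ≤ ω_n ≤ 1, the following cyclic-shift inequality holds: 1 + W_t(ω_2, ω_3, …, ω_n, ω_1) ≥ W_t(ω_1, ω_2, …, ω_n). -/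
open Finset

noncomputable section

/-- Expectation of `F` over the list obtained from `s` by appending `p11` for each success and
prepending `p01` for each failure of independent trials with probabilities `u`. -/
def obsExp (p01 p11 : ℝ) (F : List ℝ → ℝ) : List ℝ → List ℝ → ℝ
  | s, [] => F s
  | s, x :: u =>
      x * obsExp p01 p11 F (s ++ [p11]) u + (1 - x) * obsExp p01 p11 F (p01 :: s) u

/-- One step of the greedy recursion on lists, with the first `N` entries left unobserved. -/
def greedyStep (N : ℕ) (p01 p11 β : ℝ) (F : List ℝ → ℝ) (l : List ℝ) : ℝ :=
  (l.drop N).sum + β * obsExp p01 p11 F ((l.take N).map (tauF p01 p11)) (l.drop N)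

/-- The greedy value function on lists, with `r` stages of reward. -/
def greedyVal (N : ℕ) (p01 p11 β : ℝ) : ℕ → List ℝ → ℝ
  | 0 => fun _ => 0
  | r + 1 => greedyStep N p01 p11 β (greedyVal N p01 p11 β r)

end

/-- `F` is affine in each entry of the list. -/
def ListAffine (F : List ℝ → ℝ) : Prop :=
  ∀ a b x, F (a ++ x :: b) = x * F (a ++ 1 :: b) + (1 - x) * F (a ++ 0 :: b)

/-- All entries lie in the unit interval. -/
def InUnit (l : List ℝ) : Prop := ∀ z ∈ l, 0 ≤ z ∧ z ≤ 1

/-- Sorting two adjacent entries increasingly does not decrease `F`. -/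
def SwapMono (F : List ℝ → ℝ) : Prop :=
  ∀ a b x y, y ≤ x → InUnit (a ++ x :: y :: b) → F (a ++ x :: y :: b) ≤ F (a ++ y :: x :: b)

/-- Moving the first entry to the end decreases `F` by at most `1`. -/
def CyclicBound (F : List ℝ → ℝ) : Prop :=
  ∀ x l, InUnit (x :: l) → F (x :: l) ≤ 1 + F (l ++ [x])

lemma inUnit_append {a b : List ℝ} : InUnit (a ++ b) ↔ InUnit a ∧ InUnit b := by
  simp only [InUnit, List.mem_append]
  grind

lemma inUnit_cons {x : ℝ} {b : List ℝ} : InUnit (x :: b) ↔ (0 ≤ x ∧ x ≤ 1) ∧ InUnit b := by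
  simp [InUnit]

lemma inUnit_nil : InUnit [] := by simp [InUnit]

lemma ListAffine.apply_combo {F : List ℝ → ℝ} (hF : ListAffine F) (a b : List ℝ) (x p q : ℝ) :
    F (a ++ (x * p + (1 - x) * q) :: b) = x * F (a ++ p :: b) + (1 - x) * F (a ++ q :: b) := by
  rw [hF a b (x * p + (1 - x) * q), hF a b p, hF a b q]
  ring

lemma SwapMono.move_right {F : List ℝ → ℝ} (hF : SwapMono F) (x : ℝ) (b : List ℝ) :
    ∀ s a : List ℝ, (∀ z ∈ s, z ≤ x) → InUnit (a ++ x :: s ++ b) →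
      F (a ++ x :: s ++ b) ≤ F (a ++ s ++ x :: b)
  | [], a, _, _ => by simp
  | z :: s, a, hz, hu => by
      have h1 := hF a (s ++ b) x z (hz z (by simp)) (by simpa using hu)
      have h2 := hF.move_right x b s (a ++ [z]) (fun y hy => hz y (by simp [hy])) (by
        simp only [inUnit_append, inUnit_cons, inUnit_nil] at hu ⊢; tauto)
      simp only [List.append_assoc, List.cons_append, List.nil_append] at h1 h2 ⊢
      exact h1.trans h2

lemma SwapMono.move_left {F : List ℝ → ℝ} (hF : SwapMono F) (y : ℝ) (a : List ℝ) :
    ∀ s b : List ℝ, (∀ z ∈ s, y ≤ z) → InUnit (a ++ s ++ y :: b) →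
      F (a ++ s ++ y :: b) ≤ F (a ++ y :: s ++ b) := by
  intro s
  induction s using List.reverseRecOn with
  | nil => intro b _ _; simp
  | append_singleton s z ih =>
      intro b hz hu
      have h1 := hF (a ++ s) b z y (hz z (by simp)) (by simpa using hu)
      have h2 := ih (z :: b) (fun y hy => hz y (by simp [hy])) (by
        simp only [inUnit_append, inUnit_cons, inUnit_nil] at hu ⊢; tauto)
      simp only [List.append_assoc, List.cons_append, List.nil_append] at h1 h2 ⊢
      exact h1.trans h2

section

variable {p01 p11 β : ℝ} {F : List ℝ → ℝ}

lemma obsExp_perm {u v : List ℝ} (h : u.Perm v) (s : List ℝ) :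
    obsExp p01 p11 F s u = obsExp p01 p11 F s v := by
  induction h generalizing s with
  | nil => rfl
  | cons x _ ih => simp only [obsExp, ih]
  | swap x y l => simp only [obsExp, List.cons_append]; ring
  | trans _ _ ih1 ih2 => rw [ih1, ih2]

lemma obsExp_le_add (c : ℝ) {u : List ℝ} (hu : InUnit u) (s s' : List ℝ)
    (h : ∀ P Q : List ℝ, (∀ z ∈ P, z = p01) → (∀ z ∈ Q, z = p11) →
      F (P ++ s ++ Q) ≤ c + F (P ++ s' ++ Q)) :
    obsExp p01 p11 F s u ≤ c + obsExp p01 p11 F s' u := by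
  induction u generalizing s s' with
  | nil => simpa [obsExp] using h [] [] (by simp) (by simp)
  | cons x u ih =>
      rw [inUnit_cons] at hu
      have h1 := ih hu.2 (s ++ [p11]) (s' ++ [p11]) fun P Q hP hQ => by
        simpa using h P (p11 :: Q) hP (by simpa using hQ)
      have h2 := ih hu.2 (p01 :: s) (p01 :: s') fun P Q hP hQ => by
        simpa using h (P ++ [p01]) Q (by grind) hQ
      simp only [obsExp]
      nlinarith [mul_le_mul_of_nonneg_left h1 hu.1.1,
        mul_le_mul_of_nonneg_left h2 (sub_nonneg.2 hu.1.2)]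

lemma ListAffine.obsExp_left (hF : ListAffine F) (u : List ℝ) :
    ListAffine fun s => obsExp p01 p11 F s u := by
  induction u with
  | nil => exact hF
  | cons y u ih =>
      intro a b x
      have h1 := ih a (b ++ [p11]) x
      have h2 := ih (p01 :: a) b x
      simp only [obsExp, List.append_assoc, List.cons_append] at h1 h2 ⊢
      rw [h1, h2]
      ring

lemma obsExp_affine_right (s : List ℝ) : ListAffine (obsExp p01 p11 F s) := by
  intro a b x
  simp only [obsExp_perm (List.perm_middle (l₁ := a) (l₂ := b)), obsExp]
  ring

lemma inUnit_of_forall_eq {p : ℝ} (hp : p ∈ Set.Icc (0 : ℝ) 1) {P : List ℝ}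
    (h : ∀ z ∈ P, z = p) : InUnit P := fun z hz => by rw [h z hz]; exact hp

lemma SwapMono.obsExp_left (hp01 : p01 ∈ Set.Icc (0 : ℝ) 1) (hp11 : p11 ∈ Set.Icc (0 : ℝ) 1)
    (hF : SwapMono F) {u : List ℝ} (hu : InUnit u) :
    SwapMono fun s => obsExp p01 p11 F s u := by
  intro a b x y hxy hs
  have := obsExp_le_add (p01 := p01) (p11 := p11) (F := F) 0 hu (a ++ x :: y :: b)
    (a ++ y :: x :: b) fun P Q hP hQ => by
      have := hF (P ++ a) (b ++ Q) x y hxy (by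
        have := inUnit_of_forall_eq hp01 hP
        have := inUnit_of_forall_eq hp11 hQ
        simp only [inUnit_append, inUnit_cons] at hs ⊢
        tauto)
      simpa using this
  simpa using this

lemma obsExp_failure_move (hp01 : p01 ∈ Set.Icc (0 : ℝ) 1) (hp11 : p11 ∈ Set.Icc (0 : ℝ) 1)
    (hord : p01 ≤ p11) (hS : SwapMono F) (hC : CyclicBound F) {u : List ℝ} (hu : InUnit u)
    {s : List ℝ} (hs : InUnit s) :
    obsExp p01 p11 F (p01 :: s) u ≤ 1 + obsExp p01 p11 F (s ++ [p01]) u := by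
  refine obsExp_le_add 1 hu _ _ fun P Q hP hQ => ?_
  have hPu := inUnit_of_forall_eq hp01 hP
  have hQu := inUnit_of_forall_eq hp11 hQ
  have hp : 0 ≤ p01 ∧ p01 ≤ 1 := hp01
  have e : P ++ p01 :: s ++ Q = p01 :: (P ++ s ++ Q) := by
    have : P ++ [p01] = p01 :: P := by
      rw [List.eq_replicate_of_mem hP, ← List.replicate_succ', List.replicate_succ]
    simpa using congrArg (· ++ (s ++ Q)) this
  have h1 := hC p01 (P ++ s ++ Q) (by
    simp only [inUnit_append, inUnit_cons]; tauto)
  have h2 := hS.move_left p01 (P ++ s) Q [] (fun z hz => by rw [hQ z hz]; exact hord) (by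
    simp only [inUnit_append, inUnit_cons, inUnit_nil]; tauto)
  rw [e]
  simp only [List.append_assoc, List.cons_append, List.nil_append, List.append_nil] at h1 h2 ⊢
  linarith

lemma tauF_mem_s6 (hp01 : p01 ∈ Set.Icc (0 : ℝ) 1) (hp11 : p11 ∈ Set.Icc (0 : ℝ) 1)
    (hord : p01 ≤ p11) {w : ℝ} (hw : 0 ≤ w ∧ w ≤ 1) :
    p01 ≤ tauF p01 p11 w ∧ tauF p01 p11 w ≤ p11 ∧ 0 ≤ tauF p01 p11 w ∧ tauF p01 p11 w ≤ 1 := by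
  obtain ⟨h0, h1⟩ := hw
  obtain ⟨a0, a1⟩ := hp01
  obtain ⟨b0, b1⟩ := hp11
  have h : p01 ≤ tauF p01 p11 w ∧ tauF p01 p11 w ≤ p11 := by
    unfold tauF; constructor <;> nlinarith
  exact ⟨h.1, h.2, a0.trans h.1, h.2.trans b1⟩

lemma inUnit_map_tauF (hp01 : p01 ∈ Set.Icc (0 : ℝ) 1) (hp11 : p11 ∈ Set.Icc (0 : ℝ) 1)
    (hord : p01 ≤ p11) {s : List ℝ} (hs : InUnit s) : InUnit (s.map (tauF p01 p11)) := by
  intro z hz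
  obtain ⟨w, hw, rfl⟩ := List.mem_map.1 hz
  exact (tauF_mem_s6 hp01 hp11 hord (hs w hw)).2.2

lemma greedyStep_append {N : ℕ} {b u : List ℝ} (hb : b.length = N) :
    greedyStep N p01 p11 β F (b ++ u) =
      u.sum + β * obsExp p01 p11 F (b.map (tauF p01 p11)) u := by
  subst hb
  simp [greedyStep]

lemma InUnit.take {l : List ℝ} (h : InUnit l) (N : ℕ) : InUnit (l.take N) :=
  fun z hz => h z (List.mem_of_mem_take hz)

lemma InUnit.drop {l : List ℝ} (h : InUnit l) (N : ℕ) : InUnit (l.drop N) :=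
  fun z hz => h z (List.mem_of_mem_drop hz)

lemma ListAffine.map_greedyStep (hF : ListAffine F) (N : ℕ) :
    ListAffine (greedyStep N p01 p11 β F) := by
  intro a b x
  rcases Nat.lt_or_ge a.length N with h | h
  · obtain ⟨M, rfl⟩ := Nat.exists_eq_add_of_lt h
    have e (z : ℝ) : greedyStep (a.length + M + 1) p01 p11 β F (a ++ z :: b) =
        (b.drop M).sum + β * obsExp p01 p11 F (a.map (tauF p01 p11) ++ tauF p01 p11 z ::
          (b.take M).map (tauF p01 p11)) (b.drop M) := by
      simp [greedyStep, add_assoc, List.take_append, List.drop_append,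
          List.take_of_length_le, List.drop_of_length_le]
    have hA := (hF.obsExp_left (p01 := p01) (p11 := p11) (b.drop M)).apply_combo
    rw [e, e, e]
    simp only [tauF, hA]
    ring
  · have e (z : ℝ) : greedyStep N p01 p11 β F (a ++ z :: b) =
        (a.drop N).sum + (z + b.sum) + β * obsExp p01 p11 F ((a.take N).map (tauF p01 p11))
          (a.drop N ++ z :: b) := by
      simp [greedyStep, List.take_append, List.drop_append, Nat.sub_eq_zero_of_le h]
    rw [e, e, e, obsExp_affine_right _ (a.drop N) b x]
    ring

lemma SwapMono.map_greedyStep (hp01 : p01 ∈ Set.Icc (0 : ℝ) 1) (hp11 : p11 ∈ Set.Icc (0 : ℝ) 1)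
    (hord : p01 ≤ p11) (hβ : β ∈ Set.Icc (0 : ℝ) 1) (hA : ListAffine F) (hS : SwapMono F)
    (hC : CyclicBound F) (N : ℕ) : SwapMono (greedyStep N p01 p11 β F) := by
  intro a b x y hxy hu
  simp only [inUnit_append, inUnit_cons] at hu
  obtain ⟨ha, hx, hy, hb⟩ := hu
  have hs := inUnit_map_tauF hp01 hp11 hord ha
  rcases Nat.lt_or_ge a.length N with h | h
  · obtain ⟨M, rfl⟩ := Nat.exists_eq_add_of_lt h
    rcases M with _ | M
    · have e (z w : ℝ) : greedyStep (a.length + 0 + 1) p01 p11 β F (a ++ z :: w :: b) =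
          w + b.sum + β * obsExp p01 p11 F (a.map (tauF p01 p11) ++ tauF p01 p11 z :: [])
            (w :: b) := by
        simp [greedyStep, List.take_append, List.drop_append, List.take_of_length_le,
          List.drop_of_length_le]
      rw [e, e]
      generalize a.map (tauF p01 p11) = s at hs ⊢
      have hE := (hA.obsExp_left (p01 := p01) (p11 := p11) b).apply_combo
      have e1 (z : ℝ) := hE s [p11] z p11 p01
      have e2 (z : ℝ) := hE (p01 :: s) [] z p11 p01
      have h1 := obsExp_failure_move hp01 hp11 hord hS hC hb (s := s ++ [p11])
        (by simpa [inUnit_append, inUnit_cons, inUnit_nil, hs] using hp11)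
      have h2 := hS.obsExp_left hp01 hp11 hb s [] p11 p01 hord (by
        simp only [inUnit_append, inUnit_cons, inUnit_nil]; exact ⟨hs, hp11, hp01, trivial⟩)
      simp only [obsExp, tauF, List.append_assoc, List.cons_append, List.nil_append]
        at e1 e2 h1 h2 ⊢
      rw [e1, e1, e2, e2]
      have h3 := mul_nonneg (mul_nonneg hβ.1 (sub_nonneg.2 hxy))
        (sub_nonneg.2 (h1.trans (add_le_add_right h2 1)))
      nlinarith [mul_nonneg (sub_nonneg.2 hβ.2) (sub_nonneg.2 hxy)]
    · have e (z w : ℝ) : greedyStep (a.length + (M + 1) + 1) p01 p11 β F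
            (a ++ z :: w :: b) =
          (b.drop M).sum + β * obsExp p01 p11 F (a.map (tauF p01 p11) ++ tauF p01 p11 z ::
            tauF p01 p11 w :: (b.take M).map (tauF p01 p11)) (b.drop M) := by
        simp [greedyStep, add_assoc, List.take_append, List.drop_append,
          List.take_of_length_le, List.drop_of_length_le]
      rw [e, e]
      have := hS.obsExp_left hp01 hp11 (hb.drop M) (a.map (tauF p01 p11))
        ((b.take M).map (tauF p01 p11)) (tauF p01 p11 x) (tauF p01 p11 y)
        (by unfold tauF; nlinarith) (by
          simp only [inUnit_append, inUnit_cons]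
          exact ⟨hs, (tauF_mem_s6 hp01 hp11 hord hx).2.2, (tauF_mem_s6 hp01 hp11 hord hy).2.2,
            inUnit_map_tauF hp01 hp11 hord (hb.take M)⟩)
      exact add_le_add_right (mul_le_mul_of_nonneg_left this hβ.1) _
  · have e (z w : ℝ) : greedyStep N p01 p11 β F (a ++ z :: w :: b) =
        (a.drop N).sum + (z + (w + b.sum)) + β * obsExp p01 p11 F
          ((a.take N).map (tauF p01 p11)) (a.drop N ++ z :: w :: b) := by
      simp [greedyStep, List.take_append, List.drop_append, Nat.sub_eq_zero_of_le h]
    rw [e, e, obsExp_perm ((List.Perm.swap y x b).append_left (a.drop N))]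
    linarith

lemma CyclicBound.map_greedyStep (hp01 : p01 ∈ Set.Icc (0 : ℝ) 1) (hp11 : p11 ∈ Set.Icc (0 : ℝ) 1)
    (hord : p01 ≤ p11) (hβ : β ∈ Set.Icc (0 : ℝ) 1) (hA : ListAffine F) (hS : SwapMono F)
    (hC : CyclicBound F) (N : ℕ) : CyclicBound (greedyStep N p01 p11 β F) := by
  intro w l hu
  rw [inUnit_cons] at hu
  obtain ⟨hw, hl⟩ := hu
  rcases N with _ | M
  · have hp : (w :: l).Perm (l ++ [w]) := (List.perm_append_singleton w l).symm
    simp only [greedyStep, List.take_zero, List.drop_zero]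
    rw [obsExp_perm hp, hp.sum_eq]
    linarith
  rcases Nat.lt_or_ge M l.length with h | h
  · obtain ⟨σ, x, u, rfl, rfl⟩ : ∃ σ x u, l = σ ++ x :: u ∧ σ.length = M :=
      ⟨l.take M, l[M], l.drop (M + 1), by simp, by simp; omega⟩
    simp only [inUnit_append, inUnit_cons] at hl
    obtain ⟨hσ, hx, hu⟩ := hl
    have hs := inUnit_map_tauF hp01 hp11 hord hσ
    have hs1 : ∀ z ∈ σ.map (tauF p01 p11), z ≤ p11 := by
      intro z hz
      obtain ⟨v, hv, rfl⟩ := List.mem_map.1 hz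
      exact (tauF_mem_s6 hp01 hp11 hord (hσ v hv)).2.1
    have e1 := greedyStep_append (p01 := p01) (p11 := p11) (β := β) (F := F)
      (b := w :: σ) (u := x :: u) rfl
    have e2 := greedyStep_append (p01 := p01) (p11 := p11) (β := β) (F := F)
      (b := σ ++ [x]) (u := u ++ [w]) (N := σ.length + 1) (by simp)
    rw [obsExp_perm (List.perm_append_singleton w u)] at e2
    simp only [List.append_assoc, List.cons_append, List.nil_append, List.length_cons,
      List.map_cons, List.map_append, List.map_nil, List.sum_cons, List.sum_append, List.sum_nil,
      add_zero] at e1 e2 ⊢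
    rw [e1, e2]
    generalize σ.map (tauF p01 p11) = s at hs hs1 ⊢
    have hSE := hS.obsExp_left hp01 hp11 hu
    have hE := (hA.obsExp_left (p01 := p01) (p11 := p11) u).apply_combo
    have a1 := hE [] (s ++ [p11]) w p11 p01
    have a2 := hE [p01] s w p11 p01
    have a3 := hE s [p11] x p11 p01
    have a4 := hE (p01 :: s) [] x p11 p01
    have i1 := hSE.move_right p11 [p11] s [] hs1 (by
      simp only [inUnit_append, inUnit_cons, inUnit_nil]
      exact ⟨⟨trivial, hp11, hs⟩, hp11, trivial⟩)
    have i2 := obsExp_failure_move hp01 hp11 hord hS hC hu (s := p11 :: s)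
      (inUnit_cons.2 ⟨hp11, hs⟩)
    have i3 := hSE.move_right p11 [p01] s [] hs1 (by
      simp only [inUnit_append, inUnit_cons, inUnit_nil]
      exact ⟨⟨trivial, hp11, hs⟩, hp01, trivial⟩)
    have i4 := hSE s [] p11 p01 hord (by
      simp only [inUnit_append, inUnit_cons, inUnit_nil]; exact ⟨hs, hp11, hp01, trivial⟩)
    have i5 := obsExp_failure_move hp01 hp11 hord hS hC hu (s := p01 :: s)
      (inUnit_cons.2 ⟨hp01, hs⟩)
    simp only [obsExp, tauF, List.append_assoc, List.cons_append, List.nil_append]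
      at a1 a2 a3 a4 i1 i2 i3 i4 i5 ⊢
    rw [a1, a2, a3, a4]
    have j2 := (i2.trans (add_le_add_right i3 1)).trans (add_le_add_right i4 1)
    have hx' := sub_nonneg.2 hx.2
    have hw' := sub_nonneg.2 hw.2
    have k1 := mul_nonneg (mul_nonneg hx.1 hw.1) (sub_nonneg.2 i1)
    have k2 := mul_nonneg (mul_nonneg hx' hw.1) (sub_nonneg.2 j2)
    have k3 := mul_nonneg (mul_nonneg hx' hw') (sub_nonneg.2 i5)
    have k := mul_nonneg hβ.1 (add_nonneg (add_nonneg k1 k2) k3)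
    have kb := mul_nonneg (sub_nonneg.2 hβ.2) hx'
    linarith [hw.1]
  · have e (l' : List ℝ) (hl' : l'.length ≤ M + 1) :
        greedyStep (M + 1) p01 p11 β F l' = β * F (l'.map (tauF p01 p11)) := by
      simp [greedyStep, obsExp, List.take_of_length_le hl', List.drop_of_length_le hl']
    rw [e _ (by simpa using h), e _ (by simpa using h)]
    have := hC (tauF p01 p11 w) (l.map (tauF p01 p11))
      (inUnit_map_tauF hp01 hp11 hord (inUnit_cons.2 ⟨hw, hl⟩))
    simp only [List.map_cons, List.map_append, List.map_nil]
    nlinarith [mul_le_mul_of_nonneg_left this hβ.1, hβ.2]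

lemma greedyVal_properties (hp01 : p01 ∈ Set.Icc (0 : ℝ) 1) (hp11 : p11 ∈ Set.Icc (0 : ℝ) 1)
    (hord : p01 ≤ p11) (hβ : β ∈ Set.Icc (0 : ℝ) 1) (N r : ℕ) :
    ListAffine (greedyVal N p01 p11 β r) ∧ SwapMono (greedyVal N p01 p11 β r) ∧
      CyclicBound (greedyVal N p01 p11 β r) := by
  induction r with
  | zero =>
      refine ⟨fun a b x => ?_, fun a b x y _ _ => le_rfl, fun x l _ => ?_⟩ <;> simp [greedyVal]
  | succ r ih =>
      obtain ⟨hA, hS, hC⟩ := ih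
      exact ⟨hA.map_greedyStep N, hS.map_greedyStep hp01 hp11 hord hβ hA hC N,
        hC.map_greedyStep hp01 hp11 hord hβ hA hS N⟩

lemma countTrue_le {k : ℕ} (l : Fin k → Bool) : countTrue l ≤ k :=
  (Finset.card_filter_le _ _).trans (by simp)

lemma countTrue_cons {k : ℕ} (b : Bool) (l : Fin k → Bool) :
    countTrue (Fin.cons b l : Fin (k + 1) → Bool) = (if b then 1 else 0) + countTrue l := by
  simp only [countTrue, Finset.card_filter, Fin.sum_univ_succ, Fin.cons_zero, Fin.cons_succ]

lemma qProb_cons {k : ℕ} (u : Fin (k + 1) → ℝ) (b : Bool) (l : Fin k → Bool) :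
    qProb u (Fin.cons b l) = (if b then u 0 else 1 - u 0) * qProb (fun i => u i.succ) l := by
  simp [qProb, Fin.prod_univ_succ]

lemma sum_qProb_eq_obsExp {k : ℕ} (u : Fin k → ℝ) (s : List ℝ) :
    ∑ l : Fin k → Bool, qProb u l *
        F (List.replicate (k - countTrue l) p01 ++ s ++ List.replicate (countTrue l) p11) =
      obsExp p01 p11 F s (List.ofFn u) := by
  induction k generalizing s with
  | zero => simp [qProb, countTrue, obsExp]
  | succ k ih =>
      rw [← (Fin.consEquiv fun _ : Fin (k + 1) => Bool).sum_comp, Fintype.sum_prod_type,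
        Fintype.sum_bool, List.ofFn_succ, obsExp, ← ih, ← ih, Finset.mul_sum, Finset.mul_sum]
      congr 1
      · refine Finset.sum_congr rfl fun l _ => ?_
        have e : k + 1 - (1 + countTrue l) = k - countTrue l := by omega
        simp [Fin.consEquiv, qProb_cons, countTrue_cons, e, mul_assoc, List.replicate_add]
      · refine Finset.sum_congr rfl fun l _ => ?_
        have e : k + 1 - countTrue l = k - countTrue l + 1 := by
          have := countTrue_le l
          omega
        simp [Fin.consEquiv, qProb_cons, countTrue_cons, e, mul_assoc, List.replicate_add]

lemma ofFn_vl {n k m : ℕ} (hk : k ≤ n) (hm : m ≤ k) (ω : Fin n → ℝ) :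
    List.ofFn (vl k p01 p11 ω m) = List.replicate (k - m) p01 ++
      ((List.ofFn ω).take (n - k)).map (tauF p01 p11) ++ List.replicate m p11 := by
  apply List.ext_getElem
  · simp; omega
  · intro i h1 h2
    simp only [List.length_ofFn] at h1
    simp only [List.getElem_ofFn, vl, List.getElem_append, List.length_replicate,
      List.length_append, List.length_map, List.length_take, List.length_ofFn,
      List.getElem_replicate, List.getElem_map, List.getElem_take]
    split_ifs <;> first | rfl | omega

lemma ofFn_topCoords {n k : ℕ} (hk : k ≤ n) (ω : Fin n → ℝ) :
    List.ofFn (topCoords hk ω) = (List.ofFn ω).drop (n - k) := by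
  apply List.ext_getElem
  · simp; omega
  · intro i h1 h2
    simp [topCoords]

lemma sum_drop_ofFn {n : ℕ} (m : ℕ) (ω : Fin n → ℝ) :
    ((List.ofFn ω).drop m).sum = ∑ i : Fin n, if m ≤ i.val then ω i else 0 := by
  induction n generalizing m with
  | zero => simp
  | succ n ih =>
      rcases m with _ | m
      · simp [-List.ofFn_succ, List.sum_ofFn]
      · simp [List.ofFn_succ, Fin.sum_univ_succ, ih]

lemma Wval_eq_greedyVal {n k : ℕ} (hk : k ≤ n) (r : ℕ) (ω : Fin n → ℝ) :
    Wval n k hk p01 p11 β r ω = greedyVal (n - k) p01 p11 β (r + 1) (List.ofFn ω) := by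
  induction r generalizing ω with
  | zero =>
      have h (u s : List ℝ) : obsExp p01 p11 (fun _ => 0) s u = 0 := by
        induction u generalizing s with
        | nil => rfl
        | cons x u ih => simp [obsExp, ih]
      simp [Wval, greedyVal, greedyStep, sum_drop_ofFn, h]
  | succ r ih =>
      rw [Wval, greedyVal, greedyStep, sum_drop_ofFn, ← ofFn_topCoords hk, ← sum_qProb_eq_obsExp]
      simp only [ih, ofFn_vl hk (countTrue_le _)]

lemma ofFn_cyc {n : ℕ} (hn : 0 < n + 1) (ω : Fin (n + 1) → ℝ) :
    List.ofFn (cyc hn ω) = List.ofFn (fun i : Fin n => ω i.succ) ++ [ω 0] := by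
  apply List.ext_getElem
  · simp
  · intro i h1 h2
    simp only [List.length_ofFn] at h1
    simp only [List.getElem_ofFn, cyc, List.getElem_append, List.length_ofFn]
    split_ifs with h
    · congr 1
      ext
      simp [Nat.mod_eq_of_lt (Nat.succ_lt_succ h)]
    · have : i = n := by omega
      subst this
      simp

end

/-- under `p01 ≤ p11` and `β ∈ [0,1]`, for every `t ∈ {1,…,T}` and
every increasingly ordered `0 ≤ ω_1 ≤ ⋯ ≤ ω_n ≤ 1`, the cyclic-shift inequality
`1 + W_t(ω_2,…,ω_n,ω_1) ≥ W_t(ω_1,…,ω_n)` holds. -/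
theorem W_cyclic_shift_inequality
    (n k T : ℕ) (hk1 : 1 ≤ k) (hkn : k ≤ n) (hT : 1 ≤ T)
    (p01 p11 β : ℝ)
    (hp01 : p01 ∈ Set.Icc (0:ℝ) 1) (hp11 : p11 ∈ Set.Icc (0:ℝ) 1)
    (hβ : β ∈ Set.Icc (0:ℝ) 1) (hord : p01 ≤ p11)
    (t : ℕ) (ht1 : 1 ≤ t) (ht2 : t ≤ T)
    (ω : Fin n → ℝ) (hmono : Monotone ω) (hω : ∀ i, ω i ∈ Set.Icc (0:ℝ) 1) :
    1 + Wval n k hkn p01 p11 β (T - t) (cyc (by omega) ω) ≥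
      Wval n k hkn p01 p11 β (T - t) ω := by
  obtain ⟨m, rfl⟩ : ∃ m, n = m + 1 := ⟨n - 1, by omega⟩
  rw [Wval_eq_greedyVal, Wval_eq_greedyVal, ofFn_cyc, List.ofFn_succ]
  refine (greedyVal_properties hp01 hp11 hord hβ _ _).2.2 _ _ ?_
  rw [← List.ofFn_succ]
  intro z hz
  obtain ⟨i, rfl⟩ := (List.mem_ofFn' _ _).1 hz
  exact hω i
end
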